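/- Case 3 of Theorem 1.2: the hypergeometric group Γ(f,g) generated by the companion matrices A and B of f(x) = x^5 - 2x^4 + x^3 - x^2 + 2x - 1 and g(x) = x^5 - x^4 + x^3 + x^2 - x + 1 is an arithmetic subgroup of the integral orthogonal group O_Q(ℤ): Γ(f,g) is contained in O_Q(ℤ) (in particular Aᵀ·Q·A = Q and Bᵀ·Q·B = Q), and Γ(f,g) has finite index in O_Q(ℤ). -/

import Mathlib

open Matrix

/-- The companion matrix `A` of `f(x) = x^5 - 2*x^4 + x^3 - x^2 + 2*x - 1`. -/
def matA : Matrix (Fin 5) (Fin 5) ℤ :=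
  !![(0 : ℤ), 0, 0, 0, 1; 1, 0, 0, 0, -2; 0, 1, 0, 0, 1; 0, 0, 1, 0, -1; 0, 0, 0, 1, 2]

/-- The companion matrix `B` of `g(x) = x^5 - x^4 + x^3 + x^2 - x + 1`. -/
def matB : Matrix (Fin 5) (Fin 5) ℤ :=
  !![(0 : ℤ), 0, 0, 0, -1; 1, 0, 0, 0, 1; 0, 1, 0, 0, -1; 0, 0, 1, 0, -1; 0, 0, 0, 1, 1]

/-- The symmetric integer matrix `Q` of the quadratic form preserved by `Γ(f,g)`. -/
def matQ : Matrix (Fin 5) (Fin 5) ℤ :=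
  !![(3 : ℤ), 3, 1, -3, -7; 3, 3, 3, 1, -3; 1, 3, 3, 3, 1; -3, 1, 3, 3, 3; -7, -3, 1, 3, 3]

/-- The integral orthogonal group `O_Q(ℤ)` of a matrix `Q`, as the subgroup of `GL₅(ℤ)`
consisting of all `M` with `Mᵀ * Q * M = Q`. -/
def orthogonalSubgroup (Q : Matrix (Fin 5) (Fin 5) ℤ) : Subgroup (GL (Fin 5) ℤ) where
  carrier := { M : GL (Fin 5) ℤ |
      (M : Matrix (Fin 5) (Fin 5) ℤ)ᵀ * Q * (M : Matrix (Fin 5) (Fin 5) ℤ) = Q }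
  one_mem' := by simp
  mul_mem' := by
    intro a b ha hb
    simp only [Set.mem_setOf_eq, Units.val_mul, transpose_mul] at ha hb ⊢
    calc ((b : Matrix (Fin 5) (Fin 5) ℤ)ᵀ * (a : Matrix (Fin 5) (Fin 5) ℤ)ᵀ) * Q *
          ((a : Matrix (Fin 5) (Fin 5) ℤ) * (b : Matrix (Fin 5) (Fin 5) ℤ))
        = (b : Matrix (Fin 5) (Fin 5) ℤ)ᵀ *
            ((a : Matrix (Fin 5) (Fin 5) ℤ)ᵀ * Q * (a : Matrix (Fin 5) (Fin 5) ℤ)) *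
            (b : Matrix (Fin 5) (Fin 5) ℤ) := by
          simp only [mul_assoc]
      _ = Q := by rw [ha, hb]
  inv_mem' := by
    intro a ha
    simp only [Set.mem_setOf_eq] at ha ⊢
    calc ((a⁻¹ : GL (Fin 5) ℤ) : Matrix (Fin 5) (Fin 5) ℤ)ᵀ * Q *
          ((a⁻¹ : GL (Fin 5) ℤ) : Matrix (Fin 5) (Fin 5) ℤ)
        = ((a⁻¹ : GL (Fin 5) ℤ) : Matrix (Fin 5) (Fin 5) ℤ)ᵀ *
            ((a : Matrix (Fin 5) (Fin 5) ℤ)ᵀ * Q * (a : Matrix (Fin 5) (Fin 5) ℤ)) *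
            ((a⁻¹ : GL (Fin 5) ℤ) : Matrix (Fin 5) (Fin 5) ℤ) := by rw [ha]
      _ = ((a : Matrix (Fin 5) (Fin 5) ℤ) *
            ((a⁻¹ : GL (Fin 5) ℤ) : Matrix (Fin 5) (Fin 5) ℤ))ᵀ * Q *
          ((a : Matrix (Fin 5) (Fin 5) ℤ) *
            ((a⁻¹ : GL (Fin 5) ℤ) : Matrix (Fin 5) (Fin 5) ℤ)) := by
          simp only [transpose_mul, mul_assoc]
      _ = Q := by rw [Units.mul_inv]; simp

/-- A concrete `5 × 5` integer matrix, stored as its 25 entries. -/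
structure V where
  (x00 x01 x02 x03 x04 : ℤ)
  (x10 x11 x12 x13 x14 : ℤ)
  (x20 x21 x22 x23 x24 : ℤ)
  (x30 x31 x32 x33 x34 : ℤ)
  (x40 x41 x42 x43 x44 : ℤ)

namespace V

/-- The matrix with the given entries. -/
def toM (a : V) : Matrix (Fin 5) (Fin 5) ℤ :=
  !![a.x00, a.x01, a.x02, a.x03, a.x04;
    a.x10, a.x11, a.x12, a.x13, a.x14;
    a.x20, a.x21, a.x22, a.x23, a.x24;
    a.x30, a.x31, a.x32, a.x33, a.x34;
    a.x40, a.x41, a.x42, a.x43, a.x44]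

/-- Matrix multiplication. -/
def mul (a b : V) : V :=
  ⟨a.x00 * b.x00 + a.x01 * b.x10 + a.x02 * b.x20 + a.x03 * b.x30 + a.x04 * b.x40,
    a.x00 * b.x01 + a.x01 * b.x11 + a.x02 * b.x21 + a.x03 * b.x31 + a.x04 * b.x41,
    a.x00 * b.x02 + a.x01 * b.x12 + a.x02 * b.x22 + a.x03 * b.x32 + a.x04 * b.x42,
    a.x00 * b.x03 + a.x01 * b.x13 + a.x02 * b.x23 + a.x03 * b.x33 + a.x04 * b.x43,
    a.x00 * b.x04 + a.x01 * b.x14 + a.x02 * b.x24 + a.x03 * b.x34 + a.x04 * b.x44,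
    a.x10 * b.x00 + a.x11 * b.x10 + a.x12 * b.x20 + a.x13 * b.x30 + a.x14 * b.x40,
    a.x10 * b.x01 + a.x11 * b.x11 + a.x12 * b.x21 + a.x13 * b.x31 + a.x14 * b.x41,
    a.x10 * b.x02 + a.x11 * b.x12 + a.x12 * b.x22 + a.x13 * b.x32 + a.x14 * b.x42,
    a.x10 * b.x03 + a.x11 * b.x13 + a.x12 * b.x23 + a.x13 * b.x33 + a.x14 * b.x43,
    a.x10 * b.x04 + a.x11 * b.x14 + a.x12 * b.x24 + a.x13 * b.x34 + a.x14 * b.x44,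
    a.x20 * b.x00 + a.x21 * b.x10 + a.x22 * b.x20 + a.x23 * b.x30 + a.x24 * b.x40,
    a.x20 * b.x01 + a.x21 * b.x11 + a.x22 * b.x21 + a.x23 * b.x31 + a.x24 * b.x41,
    a.x20 * b.x02 + a.x21 * b.x12 + a.x22 * b.x22 + a.x23 * b.x32 + a.x24 * b.x42,
    a.x20 * b.x03 + a.x21 * b.x13 + a.x22 * b.x23 + a.x23 * b.x33 + a.x24 * b.x43,
    a.x20 * b.x04 + a.x21 * b.x14 + a.x22 * b.x24 + a.x23 * b.x34 + a.x24 * b.x44,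
    a.x30 * b.x00 + a.x31 * b.x10 + a.x32 * b.x20 + a.x33 * b.x30 + a.x34 * b.x40,
    a.x30 * b.x01 + a.x31 * b.x11 + a.x32 * b.x21 + a.x33 * b.x31 + a.x34 * b.x41,
    a.x30 * b.x02 + a.x31 * b.x12 + a.x32 * b.x22 + a.x33 * b.x32 + a.x34 * b.x42,
    a.x30 * b.x03 + a.x31 * b.x13 + a.x32 * b.x23 + a.x33 * b.x33 + a.x34 * b.x43,
    a.x30 * b.x04 + a.x31 * b.x14 + a.x32 * b.x24 + a.x33 * b.x34 + a.x34 * b.x44,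
    a.x40 * b.x00 + a.x41 * b.x10 + a.x42 * b.x20 + a.x43 * b.x30 + a.x44 * b.x40,
    a.x40 * b.x01 + a.x41 * b.x11 + a.x42 * b.x21 + a.x43 * b.x31 + a.x44 * b.x41,
    a.x40 * b.x02 + a.x41 * b.x12 + a.x42 * b.x22 + a.x43 * b.x32 + a.x44 * b.x42,
    a.x40 * b.x03 + a.x41 * b.x13 + a.x42 * b.x23 + a.x43 * b.x33 + a.x44 * b.x43,
    a.x40 * b.x04 + a.x41 * b.x14 + a.x42 * b.x24 + a.x43 * b.x34 + a.x44 * b.x44⟩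

/-- The inverse of an isometry of the form `2 (x₀ x₄ + x₁ x₃ + x₂²)`. -/
def inv (a : V) : V :=
  ⟨a.x44, a.x34, 2 * a.x24, a.x14, a.x04,
    a.x43, a.x33, 2 * a.x23, a.x13, a.x03,
    a.x42 / 2, a.x32 / 2, a.x22, a.x12 / 2, a.x02 / 2,
    a.x41, a.x31, 2 * a.x21, a.x11, a.x01,
    a.x40, a.x30, 2 * a.x20, a.x10, a.x00⟩

/-- Boolean equality test. -/
def beq (a b : V) : Bool :=
  decide (a.x00 = b.x00) &&
  decide (a.x01 = b.x01) &&
  decide (a.x02 = b.x02) &&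
  decide (a.x03 = b.x03) &&
  decide (a.x04 = b.x04) &&
  decide (a.x10 = b.x10) &&
  decide (a.x11 = b.x11) &&
  decide (a.x12 = b.x12) &&
  decide (a.x13 = b.x13) &&
  decide (a.x14 = b.x14) &&
  decide (a.x20 = b.x20) &&
  decide (a.x21 = b.x21) &&
  decide (a.x22 = b.x22) &&
  decide (a.x23 = b.x23) &&
  decide (a.x24 = b.x24) &&
  decide (a.x30 = b.x30) &&
  decide (a.x31 = b.x31) &&
  decide (a.x32 = b.x32) &&
  decide (a.x33 = b.x33) &&
  decide (a.x34 = b.x34) &&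
  decide (a.x40 = b.x40) &&
  decide (a.x41 = b.x41) &&
  decide (a.x42 = b.x42) &&
  decide (a.x43 = b.x43) &&
  decide (a.x44 = b.x44)

end V

theorem V.toM_mul (a b : V) : (a.mul b).toM = a.toM * b.toM := by
  ext i j
  fin_cases i <;> fin_cases j <;> simp [V.toM, V.mul, Matrix.mul_apply, Fin.sum_univ_succ] <;> ring

theorem V.toM_eq_of_beq {a b : V} (h : V.beq a b = true) : a.toM = b.toM := by
  simp only [V.beq, Bool.and_eq_true, decide_eq_true_eq] at h
  simp only [V.toM, h]

/-- The identity matrix. -/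
def gOne : V := ⟨1, 0, 0, 0, 0, 0, 1, 0, 0, 0, 0, 0, 1, 0, 0, 0, 0, 0, 1, 0, 0, 0, 0, 0, 1⟩

theorem toM_gOne : gOne.toM = 1 := by
  ext i j
  fin_cases i <;> fin_cases j <;> rfl

/-- Test that `a.inv` is the inverse of `a`. -/
def V.isU (a : V) : Bool := V.beq (a.mul a.inv) gOne && V.beq (a.inv.mul a) gOne

/-- The unit attached to a matrix passing the test. -/
def V.unit (a : V) (h : a.isU = true) : GL (Fin 5) ℤ where
  val := a.toM
  inv := a.inv.toM
  val_inv := by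
    simp only [V.isU, Bool.and_eq_true] at h
    rw [← V.toM_mul, V.toM_eq_of_beq h.1, toM_gOne]
  inv_val := by
    simp only [V.isU, Bool.and_eq_true] at h
    rw [← V.toM_mul, V.toM_eq_of_beq h.2, toM_gOne]

/-- The subgroup generated by a list of matrices. -/
def grp (L : List V) : Subgroup (GL (Fin 5) ℤ) :=
  Subgroup.closure {g | ∃ v ∈ L, (g : Matrix (Fin 5) (Fin 5) ℤ) = v.toM}

/-- `v` represents an element of `X`. -/
def Good (X : Subgroup (GL (Fin 5) ℤ)) (v : V) : Prop :=
  ∃ g ∈ X, (g : Matrix (Fin 5) (Fin 5) ℤ) = v.toM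

/-- Evaluation of a word in a list of letters. -/
def evalW (L : List V) : List ℕ → V
  | [] => gOne
  | i :: w => (L.getD i gOne).mul (evalW L w)

theorem good_one (X : Subgroup (GL (Fin 5) ℤ)) : Good X gOne := ⟨1, X.one_mem, by simp [toM_gOne]⟩

theorem good_mul {X : Subgroup (GL (Fin 5) ℤ)} {a b : V} (ha : Good X a) (hb : Good X b) :
    Good X (a.mul b) := by
  obtain ⟨g, hg, hga⟩ := ha
  obtain ⟨h, hh, hhb⟩ := hb
  exact ⟨g * h, X.mul_mem hg hh, by rw [Units.val_mul, hga, hhb, V.toM_mul]⟩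

theorem good_evalW {X : Subgroup (GL (Fin 5) ℤ)} {L : List V} (hL : ∀ v ∈ L, Good X v)
    (w : List ℕ) : Good X (evalW L w) := by
  induction w with
  | nil => exact good_one X
  | cons i w ih =>
    refine good_mul ?_ ih
    rw [List.getD_eq_getElem?_getD]
    rcases h : L[i]? with _ | v
    · exact good_one X
    · exact hL v (List.mem_of_getElem? h)

/-- The certificate: each `k * t` equals `t' * w` with `t'` a representative and `w` a word. -/
def chk (L K T : List V) (tbl : List (List (ℕ × List ℕ))) : Bool :=
  L.all V.isU && T.all V.isU && decide (K.length = tbl.length) &&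
  (K.zip tbl).all fun p => decide (T.length = p.2.length) &&
    (T.zip p.2).all fun q => decide (q.2.1 < T.length) &&
      V.beq (p.1.mul q.1) ((T.getD q.2.1 gOne).mul (evalW (L ++ L.map V.inv) q.2.2))

theorem good_inv {L : List V} {v : V} (hv : v ∈ L) (h : v.isU = true) :
    Good (grp L) v ∧ Good (grp L) v.inv := by
  have : v.unit h ∈ grp L := Subgroup.subset_closure ⟨v, hv, rfl⟩
  exact ⟨⟨_, this, rfl⟩, ⟨_, inv_mem this, rfl⟩⟩

open scoped Pointwise in
/-- Finite relative index from a finite set of cosets stable under generators. -/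
theorem relIndex_of_cosets {G : Type*} [Group G] (H : Subgroup G) (S : Set G) (X : Set (G ⧸ H))
    (hX : X.Finite) (h1 : ((1 : G) : G ⧸ H) ∈ X) (hS : ∀ s ∈ S, ∀ x ∈ X, s • x ∈ X) :
    H.relIndex (Subgroup.closure S) ≠ 0 := by
  have key : ∀ g ∈ Subgroup.closure S, g • X = X := by
    intro g hg
    have : Subgroup.closure S ≤ MulAction.stabilizer G X := by
      rw [Subgroup.closure_le]
      intro s hs
      rw [SetLike.mem_coe, MulAction.mem_stabilizer_iff]
      apply Set.eq_of_subset_of_ncard_le _ _ hX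
      · rintro _ ⟨x, hx, rfl⟩
        exact hS s hs x hx
      · rw [Set.ncard_smul_set]
    exact this hg
  have hmem : ∀ g ∈ Subgroup.closure S, ((g : G) : G ⧸ H) ∈ X := by
    intro g hg
    rw [← key g hg]
    exact ⟨_, h1, by simp⟩
  have := hX.to_subtype
  have hf : Finite (Subgroup.closure S ⧸ H.subgroupOf (Subgroup.closure S)) := by
    refine Finite.of_injective (β := X) (fun q => Quotient.liftOn' q
      (fun g => (⟨((g : G) : G ⧸ H), hmem g g.2⟩ : X)) ?_) ?_
    · intro a b hab
      rw [QuotientGroup.leftRel_apply] at hab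
      simp only [Subtype.mk.injEq]
      rw [QuotientGroup.eq]
      simpa [Subgroup.mem_subgroupOf] using hab
    · intro a b
      induction a using Quotient.inductionOn'
      induction b using Quotient.inductionOn'
      intro hab
      simp only [Quotient.liftOn'_mk'', Subtype.mk.injEq] at hab
      rw [QuotientGroup.eq] at hab
      apply Quotient.sound'
      rw [QuotientGroup.leftRel_apply]
      simpa [Subgroup.mem_subgroupOf] using hab
  exact Subgroup.index_ne_zero_of_finite

theorem relIndex_of_check (L K T : List V) (tbl : List (List (ℕ × List ℕ)))
    (h : chk L K (gOne :: T) tbl = true) : (grp L).relIndex (grp K) ≠ 0 := by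
  set T' := gOne :: T with hT'
  simp only [chk, Bool.and_eq_true, List.all_eq_true, decide_eq_true_eq] at h
  obtain ⟨⟨⟨hL, hT⟩, hlen⟩, hall⟩ := h
  have hgood : ∀ v ∈ L ++ L.map V.inv, Good (grp L) v := by
    intro v hv
    rw [List.mem_append, List.mem_map] at hv
    rcases hv with hv | ⟨u, hu, rfl⟩
    · exact (good_inv hv (hL v hv)).1
    · exact (good_inv hu (hL u hu)).2
  refine relIndex_of_cosets _ _
    {x | ∃ g : GL (Fin 5) ℤ, (∃ v ∈ T', (g : Matrix (Fin 5) (Fin 5) ℤ) = v.toM) ∧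
      ((g : GL (Fin 5) ℤ) : GL (Fin 5) ℤ ⧸ grp L) = x} ?_ ?_ ?_
  · have h1 : {g : GL (Fin 5) ℤ | ∃ v ∈ T', (g : Matrix (Fin 5) (Fin 5) ℤ) = v.toM}.Finite := by
      have h2 : (Set.image (fun v : V => v.toM) {v | v ∈ T'}).Finite := (List.finite_toSet T').image _
      refine Set.Finite.subset (h2.preimage (f := fun g : GL (Fin 5) ℤ => g.val) ?_) ?_
      · intro a _ b _ hab
        exact Units.ext hab
      · rintro g ⟨v, hv, hg⟩
        exact ⟨v, hv, hg.symm⟩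
    exact h1.image _
  · exact ⟨1, ⟨gOne, by simp [hT'], by simp [toM_gOne]⟩, rfl⟩
  · rintro s ⟨k, hk, hsk⟩ _ ⟨g, ⟨t, ht, hgt⟩, rfl⟩
    obtain ⟨i, hi, rfl⟩ := List.getElem_of_mem hk
    obtain ⟨j, hj, rfl⟩ := List.getElem_of_mem ht
    have hi2 : i < tbl.length := hlen ▸ hi
    obtain ⟨hl2, hrow⟩ := hall (K[i], tbl[i]) (List.mem_iff_getElem.2 ⟨i, by simp [hi, hi2], by simp⟩)
    have hj2 : j < tbl[i].length := hl2 ▸ hj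
    obtain ⟨hlt, hb⟩ := hrow (T'[j], tbl[i][j])
      (List.mem_iff_getElem.2 ⟨j, by simp [hj, hj2], by simp⟩)
    have hb := V.toM_eq_of_beq hb
    obtain ⟨w, hw, hww⟩ := good_evalW hgood (tbl[i][j]).2
    set m := (tbl[i][j]).1
    have hmem : T'.getD m gOne ∈ T' := by
      rw [List.getD_eq_getElem _ _ hlt]
      exact List.getElem_mem hlt
    refine ⟨(T'.getD m gOne).unit (hT _ hmem), ⟨_, hmem, rfl⟩, ?_⟩
    rw [MulAction.Quotient.smul_coe, QuotientGroup.eq, smul_eq_mul]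
    have : s * g = (T'.getD m gOne).unit (hT _ hmem) * w := by
      apply Units.ext
      rw [Units.val_mul, Units.val_mul, hsk, hgt, hww, ← V.toM_mul, hb, V.toM_mul]
      rfl
    rw [this]
    simpa using hw

def gA : V := ⟨0, 0, 0, 1, -1, 0, 0, 0, 0, -1, 0, 0, 1, -1, 1, -1, -1, 0, 0, 0, 0, 1, 2, -1, 1⟩
def gB : V := ⟨0, 0, 0, 1, -1, 1, 1, 2, -2, 1, -1, -1, -1, 1, -1, -1, -1, 0, 0, 0, 0, 1, 2, -1, 1⟩
def gS0 : V := ⟨1, 0, 0, 0, 0, 1, 1, 0, 0, 0, 0, 0, 1, 0, 0, 0, 0, 0, 1, 0, 0, 0, 0, -1, 1⟩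
def gS1 : V := ⟨1, 0, 0, 0, 0, 0, 0, 0, 1, 0, 0, 0, 1, 0, 0, 0, 1, 0, 0, 0, 0, 0, 0, 0, 1⟩
def gS2 : V := ⟨0, 1, 0, 0, 0, 1, 0, 0, 0, 0, 0, 0, 1, 0, 0, 0, 0, 0, 0, 1, 0, 0, 0, 1, 0⟩
def gS3 : V := ⟨1, 0, 0, 0, 0, 0, 1, 0, 0, 0, 1, 0, 1, 0, 0, 0, 0, 0, 1, 0, -1, 0, -2, 0, 1⟩
def gS4 : V := ⟨1, 0, 0, 0, 0, 0, 1, 0, 0, 0, 0, 0, -1, 0, 0, 0, 0, 0, 1, 0, 0, 0, 0, 0, 1⟩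
def gS5 : V := ⟨-1, 0, 0, 0, 0, 0, 1, 0, 0, 0, 0, 0, 1, 0, 0, 0, 0, 0, 1, 0, 0, 0, 0, 0, -1⟩
def gm9 : V := ⟨-1, 0, 0, 0, 0, 0, 1, 0, 0, 0, 1, 0, 1, 0, 0, 0, 0, 0, 1, 0, 1, 0, 2, 0, -1⟩
def gm10 : V := ⟨1, 0, 0, 0, 0, 0, 1, 0, 0, 0, 1, 0, -1, 0, 0, 0, 0, 0, 1, 0, -1, 0, 2, 0, 1⟩
def gm11 : V := ⟨1, 2, 0, 0, 0, 0, 1, 0, 0, 0, 0, 0, 1, 0, 0, 0, 0, 0, 1, -2, 0, 0, 0, 0, 1⟩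
def gm12 : V := ⟨1, 0, 2, 1, -1, 1, 0, 2, 0, -1, 0, 0, -1, -1, 1, -1, -1, 0, 0, 0, 1, 1, 0, -1, 1⟩
def gm13 : V := ⟨-2, -2, 0, 1, -1, -1, -1, 0, 1, -1, 2, 2, -1, -2, 2, -2, 0, -4, -1, 2, 3, 2, 0, -3, 2⟩
def gm14 : V := ⟨0, 0, 0, 1, 0, 0, 0, 0, 0, 1, 0, 0, 1, 0, 0, 1, 0, 0, 0, 0, 0, 1, 0, 0, 0⟩
def gm15 : V := ⟨1, 0, 0, 0, 0, 1, 0, 0, 1, 0, 0, 0, 1, 0, 0, 0, 1, 0, 0, 0, 0, -1, 0, 0, 1⟩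
def gm16 : V := ⟨0, 1, 0, 0, 0, 0, 0, 0, 0, 1, 0, 0, 1, 0, 0, 1, 0, 0, 0, 0, 0, 0, 0, 1, 0⟩
def gm17 : V := ⟨0, 1, 0, 0, 0, 1, 0, 0, 0, 0, 0, 1, 1, 0, 0, 0, 0, 0, 0, 1, 0, -1, -2, 1, 0⟩
def gm18 : V := ⟨0, 1, 0, 0, 0, 0, 1, 0, 0, 1, 0, 0, 1, 0, 0, 1, 0, 0, 0, 0, -1, 0, 0, 1, 0⟩
def gm19 : V := ⟨0, 1, 0, 0, 1, 0, 1, 0, 0, 0, 0, 0, 1, 0, 0, -1, 0, 0, 1, 0, 1, 0, 0, 0, 0⟩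
def gm20 : V := ⟨0, 1, 0, 0, 1, 0, 1, 0, 0, 0, 0, 1, 1, 0, 1, -1, 0, 0, 1, 0, 1, -1, -2, 0, -1⟩

theorem step0 : (grp [gA, gB]).relIndex (grp [gA, gB, gm9]) ≠ 0 := by
  refine relIndex_of_check _ _ [gm9]
    [[(0, [0]), (1, [2])],
      [(0, [1]), (1, [0, 0, 0, 3, 2, 2, 2])],
      [(1, []), (0, [])]] ?_
  decide +kernel

theorem step1 : (grp [gA, gB, gm9]).relIndex (grp [gA, gB, gm9, gm10]) ≠ 0 := by
  refine relIndex_of_check _ _ [gm10]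
    [[(0, [0]), (1, [0, 0, 4, 3, 2, 4, 3, 1, 1, 2, 4, 3, 1])],
      [(0, [1]), (1, [0, 0, 4, 3, 2, 4, 3, 1, 1, 2, 4])],
      [(0, [2]), (1, [1, 2, 4, 3, 1, 0, 4, 2, 4, 2, 4, 4, 4, 0, 0, 1, 0, 1, 3])],
      [(1, []), (0, [])]] ?_
  decide +kernel

theorem step2 : (grp [gA, gB, gm9, gm10]).relIndex (grp [gA, gB, gm9, gm10, gm11]) ≠ 0 := by
  refine relIndex_of_check _ _ [gm11]
    [[(0, [0]), (1, [0, 0, 1, 1, 0, 5, 5, 5, 5])],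
      [(0, [1]), (1, [0, 5, 5, 5, 4, 1, 0, 1, 1, 0, 5])],
      [(0, [2]), (1, [0, 5, 5, 4, 5, 5, 4, 4, 2])],
      [(0, [3]), (1, [4, 2, 3, 0, 3, 4, 3, 4, 2])],
      [(1, []), (0, [0, 1, 1, 1, 1, 1, 0, 5])]] ?_
  decide +kernel

theorem step3 : (grp [gA, gB, gm9, gm10, gm11]).relIndex (grp [gA, gB, gm11, gS3, gS5]) ≠ 0 := by
  refine relIndex_of_check _ _ [gS3, gm12, gm13]
    [[(0, [0]), (2, []), (3, []), (1, [0, 0, 9, 0, 0, 0, 4, 5, 5])],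
      [(0, [1]), (2, [0, 0, 9, 5, 1, 4, 5, 5]), (3, [0, 0, 9, 5, 5, 1, 0, 4, 5, 5]), (1, [0, 9, 0, 1, 0, 0, 4, 5, 5])],
      [(0, [4]), (1, [0, 4, 5]), (2, [0, 0, 4, 5, 5]), (3, [0, 1, 4, 6, 5])],
      [(1, []), (2, [0, 0, 6, 6, 6, 5, 2, 3, 7]), (3, [0, 0, 6, 6, 6, 9, 3, 4, 5]), (0, [4, 5, 4, 5])],
      [(1, [2]), (0, [2]), (3, [2, 1, 1, 1, 2, 3, 5, 2]), (2, [5, 2, 3, 2, 6, 6, 6, 2])]] ?_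
  decide +kernel

theorem step4 : (grp [gA, gB, gm11, gS3, gS5]).relIndex (grp [gB, gS3, gS4, gS5, gm14]) ≠ 0 := by
  refine relIndex_of_check _ _ [gm14]
    [[(0, [1]), (1, [3, 0, 6, 5, 8])],
      [(0, [3]), (1, [5, 2, 8, 1, 1, 7, 8])],
      [(0, [5, 8, 5, 8, 0, 1, 1, 1, 5]), (1, [5, 8, 5, 8, 0, 1, 1, 1, 5])],
      [(0, [4]), (1, [0, 7, 4, 5])],
      [(1, []), (0, [])]] ?_
  decide +kernel

theorem step5 : (grp [gB, gS3, gS4, gS5, gm14]).relIndex (grp [gS0, gS1, gS2, gS3, gS4, gS5]) ≠ 0 := by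
  refine relIndex_of_check _ _ [gS0, gS1, gS2, gm15, gm16, gm17, gm18, gm19, gm20]
    [[(1, []), (0, [4, 5, 4, 0]), (4, []), (3, [1, 2, 4, 6, 4, 0, 3, 4]), (2, [0, 6, 0, 6, 5, 1, 5, 6]), (7, []), (6, [1, 2, 4, 6, 4, 0, 3, 4]), (5, [0, 6, 0, 1, 5, 1, 5, 1]), (8, [0, 0, 3, 0, 2, 4, 6, 6]), (9, [0, 0, 3, 0, 2, 4, 6, 6])],
      [(2, []), (1, [5, 5, 4, 1, 5, 3, 4]), (0, []), (5, []), (4, [2, 4, 6, 5, 1, 3, 0, 1, 4]), (3, []), (7, [0, 6, 4, 0, 0, 6, 5, 4]), (6, [5, 4, 1, 5, 5, 2, 4, 6]), (8, [5, 5, 4, 1, 5, 3, 4]), (9, [5, 5, 4, 1, 5, 3, 4])],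
      [(3, []), (1, [5, 1, 5, 2, 3, 4, 3, 0, 1]), (2, [4]), (0, []), (6, [0, 1, 2, 5, 2, 4, 3, 4, 5]), (5, [4]), (4, [0, 6, 4, 1, 5, 1, 3, 4, 5]), (8, []), (7, []), (9, [0, 0, 3, 4, 0, 1, 5, 1, 3])],
      [(0, [1]), (1, [1]), (2, [1]), (6, []), (4, [1]), (7, [0, 6, 4, 0, 0, 6, 5, 4]), (3, [6, 2, 5, 1, 1, 2, 0, 6]), (5, [0, 6, 0, 0, 4, 6, 4, 5]), (9, []), (8, [6, 5, 4, 1, 0, 1, 4, 6, 5, 6, 0, 6, 5, 5, 5, 5])],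
      [(0, [2]), (1, [2]), (2, [2]), (3, [2]), (4, [2]), (5, [2]), (6, [0, 6, 0, 2, 5, 1, 5]), (7, [2]), (8, [2]), (9, [5, 6, 0, 6, 5, 5, 6, 0, 6, 5, 5, 6, 0, 6, 5])],
      [(0, [3]), (1, [5, 4, 0, 4, 3]), (2, [3]), (3, [4, 3, 4]), (4, [0, 1, 2, 0, 0, 3, 0, 1, 5]), (5, [4, 3, 4]), (6, [0, 3, 0, 4, 3, 5, 5, 4, 3]), (7, [5, 5, 2, 4, 6, 6, 5, 3, 4]), (8, [0, 6, 0, 6, 5, 1, 5, 6, 3]), (9, [0, 0, 3, 5, 5, 2, 4, 6, 6, 0, 0, 0, 9])]] ?_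
  decide +kernel


/-! ### The orthogonal group of `x₀ x₄ + x₁ x₃ + x₂²` is generated by six elements -/

/-- The quadratic form `x₀ x₄ + x₁ x₃ + x₂²`. -/
def qf (v : Fin 5 → ℤ) : ℤ := v 0 * v 4 + v 1 * v 3 + v 2 ^ 2

/-- The isometries of `qf`. -/
def isoG : Subgroup (GL (Fin 5) ℤ) where
  carrier := {g | ∀ v, qf (g.val *ᵥ v) = qf v}
  one_mem' := by intro v; simp
  mul_mem' := by
    intro a b ha hb v
    rw [Units.val_mul, ← Matrix.mulVec_mulVec, ha, hb]
  inv_mem' := by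
    intro a ha v
    have h := ha (a⁻¹.val *ᵥ v)
    rw [Matrix.mulVec_mulVec, Units.mul_inv, Matrix.one_mulVec] at h
    exact h.symm

/-- The stabilizer of a vector. -/
def fixG (e : Fin 5 → ℤ) : Subgroup (GL (Fin 5) ℤ) where
  carrier := {g | g.val *ᵥ e = e}
  one_mem' := by simp
  mul_mem' := by
    intro a b (ha : _ = _) (hb : _ = _)
    change _ = _
    rw [Units.val_mul, ← Matrix.mulVec_mulVec, hb, ha]
  inv_mem' := by
    intro a (ha : _ = _)
    change _ = _
    conv_lhs => rw [← ha, Matrix.mulVec_mulVec, Units.inv_mul, Matrix.one_mulVec]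

/-- Being in the same orbit under a subgroup `X`. -/
def VRel (X : Subgroup (GL (Fin 5) ℤ)) (v w : Fin 5 → ℤ) : Prop := ∃ h ∈ X, h.val *ᵥ v = w

theorem VRel.refl (X : Subgroup (GL (Fin 5) ℤ)) (v : Fin 5 → ℤ) : VRel X v v := ⟨1, X.one_mem, by simp⟩

theorem VRel.trans {X : Subgroup (GL (Fin 5) ℤ)} {u v w : Fin 5 → ℤ} (h1 : VRel X u v)
    (h2 : VRel X v w) : VRel X u w := by
  obtain ⟨a, ha, rfl⟩ := h1
  obtain ⟨b, hb, rfl⟩ := h2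
  exact ⟨b * a, X.mul_mem hb ha, by rw [Units.val_mul, ← Matrix.mulVec_mulVec]⟩

theorem VRel.symm {X : Subgroup (GL (Fin 5) ℤ)} {u v : Fin 5 → ℤ} (h1 : VRel X u v) : VRel X v u := by
  obtain ⟨a, ha, rfl⟩ := h1
  exact ⟨a⁻¹, X.inv_mem ha, by rw [Matrix.mulVec_mulVec, Units.inv_mul, Matrix.one_mulVec]⟩

theorem VRel.iter {X : Subgroup (GL (Fin 5) ℤ)} (φ : ℤ → Fin 5 → ℤ)
    (h : ∀ k, VRel X (φ k) (φ (k + 1))) (k : ℤ) : VRel X (φ 0) (φ k) := by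
  induction k using Int.induction_on with
  | zero => exact VRel.refl _ _
  | succ i ih => exact ih.trans (h _)
  | pred i ih =>
    have := h (-(i : ℤ) - 1)
    rw [sub_add_cancel] at this
    exact ih.trans this.symm

/-- Primitive vectors. -/
def Prim (v : Fin 5 → ℤ) : Prop := ∃ u : Fin 5 → ℤ, u ⬝ᵥ v = 1

theorem VRel.prim {X : Subgroup (GL (Fin 5) ℤ)} {v w : Fin 5 → ℤ} (h : VRel X v w) (hv : Prim v) :
    Prim w := by
  obtain ⟨g, -, rfl⟩ := h
  obtain ⟨u, hu⟩ := hv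
  refine ⟨u ᵥ* g⁻¹.val, ?_⟩
  rw [Matrix.dotProduct_mulVec, Matrix.vecMul_vecMul, Units.inv_mul, Matrix.vecMul_one, hu]

theorem VRel.qf_eq {X : Subgroup (GL (Fin 5) ℤ)} (hX : X ≤ isoG) {v w : Fin 5 → ℤ} (h : VRel X v w) :
    qf w = qf v := by
  obtain ⟨g, hg, rfl⟩ := h
  exact hX hg v

theorem Prim.dvd {a b c d f n : ℤ} (h : Prim ![a, b, c, d, f]) (ha : n ∣ a) (hb : n ∣ b) (hc : n ∣ c)
    (hd : n ∣ d) (hf : n ∣ f) : n ∣ 1 := by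
  obtain ⟨u, hu⟩ := h
  rw [← hu]
  simp only [dotProduct, Fin.sum_univ_five]
  simp only [Matrix.cons_val]
  exact dvd_add (dvd_add (dvd_add (dvd_add (ha.mul_left _) (hb.mul_left _)) (hc.mul_left _))
    (hd.mul_left _)) (hf.mul_left _)

@[simp] theorem qf_vec (a b c d f : ℤ) : qf ![a, b, c, d, f] = a * f + b * d + c ^ 2 := by
  simp [qf]

/-- Generator: `b += a`, `f -= d`. -/
def s0 : GL (Fin 5) ℤ := gS0.unit (by decide +kernel)
/-- Generator: swap `b`, `d`. -/
def s1 : GL (Fin 5) ℤ := gS1.unit (by decide +kernel)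
/-- Generator: swap `(a, f)` and `(b, d)`. -/
def s2 : GL (Fin 5) ℤ := gS2.unit (by decide +kernel)
/-- Generator: `c += a`, `f -= 2 c + a`. -/
def s3 : GL (Fin 5) ℤ := gS3.unit (by decide +kernel)
/-- Generator: `c ↦ -c`. -/
def s4 : GL (Fin 5) ℤ := gS4.unit (by decide +kernel)
/-- Generator: `a ↦ -a`, `f ↦ -f`. -/
def s5 : GL (Fin 5) ℤ := gS5.unit (by decide +kernel)

theorem act0 (a b c d f : ℤ) : s0.val *ᵥ ![a, b, c, d, f] = ![a, b + a, c, d, f - d] := by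
  ext i
  fin_cases i <;> simp [s0, V.unit, V.toM, gS0, Matrix.mulVec, dotProduct, Fin.sum_univ_succ] <;> ring
theorem act1 (a b c d f : ℤ) : s1.val *ᵥ ![a, b, c, d, f] = ![a, d, c, b, f] := by
  ext i
  fin_cases i <;> simp [s1, V.unit, V.toM, gS1, Matrix.mulVec, dotProduct, Fin.sum_univ_succ]
theorem act2 (a b c d f : ℤ) : s2.val *ᵥ ![a, b, c, d, f] = ![b, a, c, f, d] := by
  ext i
  fin_cases i <;> simp [s2, V.unit, V.toM, gS2, Matrix.mulVec, dotProduct, Fin.sum_univ_succ]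
theorem act3 (a b c d f : ℤ) :
    s3.val *ᵥ ![a, b, c, d, f] = ![a, b, c + a, d, f - 2 * c - a] := by
  ext i
  fin_cases i <;> simp [s3, V.unit, V.toM, gS3, Matrix.mulVec, dotProduct, Fin.sum_univ_succ] <;> ring
theorem act4 (a b c d f : ℤ) : s4.val *ᵥ ![a, b, c, d, f] = ![a, b, -c, d, f] := by
  ext i
  fin_cases i <;> simp [s4, V.unit, V.toM, gS4, Matrix.mulVec, dotProduct, Fin.sum_univ_succ]
theorem act5 (a b c d f : ℤ) : s5.val *ᵥ ![a, b, c, d, f] = ![-a, b, c, d, -f] := by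
  ext i
  fin_cases i <;> simp [s5, V.unit, V.toM, gS5, Matrix.mulVec, dotProduct, Fin.sum_univ_succ]

theorem vec5 (v : Fin 5 → ℤ) : v = ![v 0, v 1, v 2, v 3, v 4] := by
  ext i
  fin_cases i <;> rfl

theorem vec_congr {a b c d f a' b' c' d' f' : ℤ} (h0 : a = a') (h1 : b = b') (h2 : c = c')
    (h3 : d = d') (h4 : f = f') : ![a, b, c, d, f] = ![a', b', c', d', f'] := by
  rw [h0, h1, h2, h3, h4]

/-- The group generated by the six generators. -/
def grE : Subgroup (GL (Fin 5) ℤ) := grp [gS0, gS1, gS2, gS3, gS4, gS5]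

theorem s0_mem : s0 ∈ grE := Subgroup.subset_closure ⟨gS0, by simp, rfl⟩
theorem s1_mem : s1 ∈ grE := Subgroup.subset_closure ⟨gS1, by simp, rfl⟩
theorem s2_mem : s2 ∈ grE := Subgroup.subset_closure ⟨gS2, by simp, rfl⟩
theorem s3_mem : s3 ∈ grE := Subgroup.subset_closure ⟨gS3, by simp, rfl⟩
theorem s4_mem : s4 ∈ grE := Subgroup.subset_closure ⟨gS4, by simp, rfl⟩
theorem s5_mem : s5 ∈ grE := Subgroup.subset_closure ⟨gS5, by simp, rfl⟩

theorem grE_le : grE ≤ isoG := by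
  unfold grE grp
  rw [Subgroup.closure_le]
  rintro g ⟨v, hv, hg⟩ x
  rw [vec5 x]
  generalize x 0 = a
  generalize x 1 = b
  generalize x 2 = c
  generalize x 3 = d
  generalize x 4 = f
  simp only [List.mem_cons, List.not_mem_nil, or_false] at hv
  rcases hv with rfl | rfl | rfl | rfl | rfl | rfl
  · rw [show g = s0 from Units.ext hg, act0, qf_vec, qf_vec]; ring
  · rw [show g = s1 from Units.ext hg, act1, qf_vec, qf_vec]; ring
  · rw [show g = s2 from Units.ext hg, act2, qf_vec, qf_vec]; ring
  · rw [show g = s3 from Units.ext hg, act3, qf_vec, qf_vec]; ring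
  · rw [show g = s4 from Units.ext hg, act4, qf_vec, qf_vec]; ring
  · rw [show g = s5 from Units.ext hg, act5, qf_vec, qf_vec]; ring

theorem rel_of {X : Subgroup (GL (Fin 5) ℤ)} {g : GL (Fin 5) ℤ} (hg : g ∈ X) {v w : Fin 5 → ℤ}
    (h : g.val *ᵥ v = w) : VRel X v w := ⟨g, hg, h⟩

theorem mv0 (k a b c d f : ℤ) : VRel grE ![a, b, c, d, f] ![a, b + k * a, c, d, f - k * d] := by
  have := VRel.iter (X := grE) (fun k => ![a, b + k * a, c, d, f - k * d]) (fun k => rel_of s0_mem (by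
    rw [act0]; congr! 1; congr! 1; · ring
    congr! 1; congr! 1; congr! 1; ring)) k
  simpa using this

theorem sw1 (a b c d f : ℤ) : VRel grE ![a, b, c, d, f] ![a, d, c, b, f] := rel_of s1_mem (act1 ..)
theorem sw2 (a b c d f : ℤ) : VRel grE ![a, b, c, d, f] ![b, a, c, f, d] := rel_of s2_mem (act2 ..)

theorem mv1 (k a b c d f : ℤ) : VRel grE ![a, b, c, d, f] ![a, b, c, d + k * a, f - k * b] :=
  ((sw1 ..).trans (mv0 k ..)).trans (sw1 ..)

theorem mv2 (k a b c d f : ℤ) : VRel grE ![a, b, c, d, f] ![a + k * b, b, c, d - k * f, f] :=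
  ((sw2 ..).trans (mv0 k ..)).trans (sw2 ..)

theorem mv3 (k a b c d f : ℤ) :
    VRel grE ![a, b, c, d, f] ![a, b, c + k * a, d, f - 2 * k * c - k ^ 2 * a] := by
  have := VRel.iter (X := grE) (fun k => ![a, b, c + k * a, d, f - 2 * k * c - k ^ 2 * a])
    (fun k => rel_of s3_mem (by
      rw [act3]; congr! 1; congr! 1; congr! 1; · ring
      congr! 1; congr! 1; ring)) k
  simpa using this

theorem reduce_aux (n : ℕ) : ∀ a b c d f : ℤ, a ≠ 0 → a.natAbs = n → a * f + b * d + c ^ 2 = 0 →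
    Prim ![a, b, c, d, f] → VRel grE ![a, b, c, d, f] ![1, 0, 0, 0, 0] := by
  induction n using Nat.strong_induction_on with
  | _ n ih =>
  intro a b c d f ha hn hq hp
  -- recursion step
  have rec1 : ∀ a' b' c' d' f' : ℤ, VRel grE ![a, b, c, d, f] ![a', b', c', d', f'] → a' ≠ 0 →
      |a'| < |a| → VRel grE ![a, b, c, d, f] ![1, 0, 0, 0, 0] := by
    intro a' b' c' d' f' hr h0 hlt
    refine hr.trans (ih a'.natAbs ?_ a' b' c' d' f' h0 rfl ?_ (hr.prim hp))
    · rw [← hn]; zify; exact hlt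
    · rw [← qf_vec, hr.qf_eq grE_le, qf_vec, hq]
  by_cases hb : a ∣ b
  swap
  · refine rec1 _ _ _ _ _ ((mv0 (-(b / a)) ..).trans (sw2 ..)) ?_ ?_
    · intro h
      exact hb (Int.dvd_of_emod_eq_zero (by rw [Int.emod_def]; linarith))
    · have h1 := Int.emod_nonneg b ha
      have h2 := Int.emod_lt_abs b ha
      rw [show b + -(b / a) * a = b % a by rw [Int.emod_def]; ring, abs_of_nonneg h1]
      exact h2
  by_cases hd : a ∣ d
  swap
  · refine rec1 _ _ _ _ _ (((mv1 (-(d / a)) ..).trans (sw1 ..)).trans (sw2 ..)) ?_ ?_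
    · intro h
      exact hd (Int.dvd_of_emod_eq_zero (by rw [Int.emod_def]; linarith))
    · have h1 := Int.emod_nonneg d ha
      have h2 := Int.emod_lt_abs d ha
      rw [show d + -(d / a) * a = d % a by rw [Int.emod_def]; ring, abs_of_nonneg h1]
      exact h2
  obtain ⟨b', rfl⟩ := hb
  obtain ⟨d', rfl⟩ := hd
  have r1 := (mv0 (-b') a (a * b') c (a * d') f).trans (mv1 (-d') ..)
  rw [show a * b' + -b' * a = 0 by ring, show a * d' + -d' * a = 0 by ring,
    show f - -b' * (a * d') - -d' * 0 = f + b' * d' * a by ring] at r1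
  set f1 := f + b' * d' * a with hf1
  by_cases hf : a ∣ f1
  swap
  · refine rec1 _ _ _ _ _ (r1.trans (((mv2 (-1) ..).trans (mv1 (-(f1 / a)) ..)).trans
      ((sw1 ..).trans (sw2 ..)))) ?_ ?_
    · intro h
      exact hf (Int.dvd_of_emod_eq_zero (by rw [Int.emod_def]; linarith))
    · have h1 := Int.emod_nonneg f1 ha
      have h2 := Int.emod_lt_abs f1 ha
      rw [show 0 - -1 * f1 + -(f1 / a) * (a + -1 * 0) = f1 % a by rw [Int.emod_def]; ring,
        abs_of_nonneg h1]
      exact h2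
  have hq1 : a * f1 + c ^ 2 = 0 := by
    have := r1.qf_eq grE_le
    rw [qf_vec, qf_vec, hq] at this
    linarith
  have hc : a ∣ c := by
    obtain ⟨m, hm⟩ := hf
    rw [← Int.pow_dvd_pow_iff (n := 2) (by norm_num)]
    exact ⟨-m, by rw [hm] at hq1; linarith⟩
  have hunit : a ∣ 1 := (r1.prim hp).dvd dvd_rfl (dvd_zero _) hc (dvd_zero _) hf
  obtain ⟨c', rfl⟩ := hc
  have r2 := r1.trans (mv3 (-c') ..)
  have hq2 := r2.qf_eq grE_le
  rw [qf_vec, qf_vec, hq] at hq2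
  rw [show a * c' + -c' * a = 0 by ring] at r2 hq2
  set f2 := f1 - 2 * -c' * (a * c') - (-c') ^ 2 * a
  have hf2 : f2 = 0 := by
    have : a * f2 = 0 := by linarith
    exact (mul_eq_zero.1 this).resolve_left ha
  rw [hf2] at r2
  rcases Int.isUnit_iff.1 (isUnit_of_dvd_one hunit) with rfl | rfl
  · exact r2
  · exact r2.trans (rel_of s5_mem (by rw [act5]; simp))

theorem reduce_vec (v : Fin 5 → ℤ) (hq : qf v = 0) (hp : Prim v) : VRel grE v ![1, 0, 0, 0, 0] := by
  rw [vec5 v] at hq hp ⊢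
  generalize v 0 = a at *
  generalize v 1 = b at *
  generalize v 2 = c at *
  generalize v 3 = d at *
  generalize v 4 = f at *
  rw [qf_vec] at hq
  by_cases ha : a = 0
  swap
  · exact reduce_aux _ a b c d f ha rfl hq hp
  have key : ∀ a' b' c' d' f' : ℤ, VRel grE ![a, b, c, d, f] ![a', b', c', d', f'] → a' ≠ 0 →
      VRel grE ![a, b, c, d, f] ![1, 0, 0, 0, 0] := by
    intro a' b' c' d' f' hr h0
    refine hr.trans (reduce_aux _ a' b' c' d' f' h0 rfl ?_ (hr.prim hp))
    rw [← qf_vec, hr.qf_eq grE_le, qf_vec, hq]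
  by_cases hb : b = 0
  swap
  · exact key _ _ _ _ _ (sw2 ..) hb
  by_cases hd : d = 0
  swap
  · exact key _ _ _ _ _ ((sw1 ..).trans (sw2 ..)) hd
  by_cases hf : f = 0
  swap
  · exact key _ _ _ _ _ (((sw2 ..).trans (sw1 ..)).trans (sw2 ..)) hf
  subst ha hb hd hf
  have hc : c = 0 := by simpa using hq
  have := hp.dvd (n := 0) (by simp) (by simp) (by simp [hc]) (by simp) (by simp)
  simp at this

/-! Stabilizers -/

/-- The flip `a ↔ f`. -/
def s6 : GL (Fin 5) ℤ := s2 * s1 * s2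

theorem s6_mem : s6 ∈ grE := mul_mem (mul_mem s2_mem s1_mem) s2_mem

theorem act_mul (g h : GL (Fin 5) ℤ) (v : Fin 5 → ℤ) :
    (g * h).val *ᵥ v = g.val *ᵥ (h.val *ᵥ v) := by
  rw [Units.val_mul, ← Matrix.mulVec_mulVec]

theorem act6 (a b c d f : ℤ) : s6.val *ᵥ ![a, b, c, d, f] = ![f, b, c, d, a] := by
  rw [s6, act_mul, act_mul, act2, act1, act2]

/-- Elements of `grE` fixing `e₀`. -/
def grX1 : Subgroup (GL (Fin 5) ℤ) := grE ⊓ fixG ![1, 0, 0, 0, 0]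
/-- Elements of `grE` fixing `e₀, e₄`. -/
def grX2 : Subgroup (GL (Fin 5) ℤ) := grX1 ⊓ fixG ![0, 0, 0, 0, 1]
/-- Elements of `grE` fixing `e₀, e₄, e₁`. -/
def grX3 : Subgroup (GL (Fin 5) ℤ) := grX2 ⊓ fixG ![0, 1, 0, 0, 0]
/-- Elements of `grE` fixing `e₀, e₄, e₁, e₃`. -/
def grX4 : Subgroup (GL (Fin 5) ℤ) := grX3 ⊓ fixG ![0, 0, 0, 1, 0]

theorem grX1_le : grX1 ≤ grE := inf_le_left
theorem grX2_le : grX2 ≤ grE := inf_le_left.trans grX1_le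
theorem grX3_le : grX3 ≤ grE := inf_le_left.trans grX2_le
theorem grX4_le : grX4 ≤ grE := inf_le_left.trans grX3_le

theorem mem_fixG {g : GL (Fin 5) ℤ} {e : Fin 5 → ℤ} : g ∈ fixG e ↔ g.val *ᵥ e = e := Iff.rfl

theorem x1a : s6 * s0 * s6 ∈ grX1 :=
  ⟨mul_mem (mul_mem s6_mem s0_mem) s6_mem, by
    refine mem_fixG.2 ?_; simp only [act_mul, act6, act0] <;> simp⟩

theorem x1b : s6 * s1 * s0 * s1 * s6 ∈ grX1 :=
  ⟨mul_mem (mul_mem (mul_mem (mul_mem s6_mem s1_mem) s0_mem) s1_mem) s6_mem, by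
    refine mem_fixG.2 ?_; simp only [act_mul, act6, act0, act1] <;> simp⟩

theorem x1c : s6 * s3 * s6 ∈ grX1 :=
  ⟨mul_mem (mul_mem s6_mem s3_mem) s6_mem, by
    refine mem_fixG.2 ?_; simp only [act_mul, act6, act3] <;> simp⟩

theorem stage2 (a b c d : ℤ) (hq : a + b * d + c ^ 2 = 0) :
    VRel grX1 ![a, b, c, d, 1] ![0, 0, 0, 0, 1] := by
  have r1 := VRel.iter (X := grX1) (fun k => ![a - k * d, b + k, c, d, 1]) (fun k => rel_of x1a (by
    simp only [act_mul, act6, act0]; congr! 1; · ring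
    congr! 1; ring)) (-b)
  have r2 := fun a' => VRel.iter (X := grX1) (fun k => ![a', 0, c, d + k, 1]) (fun k => rel_of x1b (by
    simp only [act_mul, act6, act0, act1]; exact vec_congr (by ring) (by ring) (by ring) (by ring) (by ring))) (-d)
  have r3 := fun a' => VRel.iter (X := grX1) (fun k => ![a' - 2 * k * c - k ^ 2, 0, c + k, 0, 1])
    (fun k => rel_of x1c (by
      simp only [act_mul, act6, act3]; congr! 1; · ring
      congr! 2; ring)) (-c)
  simp only [zero_mul, sub_zero, add_zero, mul_zero, add_neg_cancel, ne_eq, OfNat.ofNat_ne_zero,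
    not_false_eq_true, zero_pow] at r1 r2 r3
  have := (r1.trans (r2 _)).trans (r3 _)
  rwa [show a - -b * d - 2 * -c * c - (-c) ^ 2 = 0 by linarith] at this

theorem x2a : s1 ∈ grX2 :=
  ⟨⟨s1_mem, by simp [mem_fixG, act1]⟩, by simp [mem_fixG, act1]⟩

theorem x2b : s2 * s3 * s2 ∈ grX2 :=
  ⟨⟨mul_mem (mul_mem s2_mem s3_mem) s2_mem, by
    refine mem_fixG.2 ?_; simp only [act_mul, act2, act3] <;> simp⟩, by
    refine mem_fixG.2 ?_; simp only [act_mul, act2, act3] <;> simp⟩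

theorem x2c : s2 * s5 * s2 ∈ grX2 :=
  ⟨⟨mul_mem (mul_mem s2_mem s5_mem) s2_mem, by
    refine mem_fixG.2 ?_; simp only [act_mul, act2, act5] <;> simp⟩, by
    refine mem_fixG.2 ?_; simp only [act_mul, act2, act5] <;> simp⟩

theorem mvX (k b c d : ℤ) :
    VRel grX2 ![0, b, c, d, 0] ![0, b, c + k * b, d - 2 * k * c - k ^ 2 * b, 0] := by
  have := VRel.iter (X := grX2) (fun k => ![0, b, c + k * b, d - 2 * k * c - k ^ 2 * b, 0])
    (fun k => rel_of x2b (by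
      simp only [act_mul, act3, act2]; congr! 3; · ring
      congr! 1; ring)) k
  simpa using this

theorem stage3 (n : ℕ) : ∀ b c d : ℤ, b.natAbs = n → b * d + c ^ 2 = 0 →
    Prim ![0, b, c, d, 0] → VRel grX2 ![0, b, c, d, 0] ![0, 1, 0, 0, 0] := by
  induction n using Nat.strong_induction_on with
  | _ n ih =>
  intro b c d hn hq hp
  have sgn : ∀ x : ℤ, x ∣ 1 → VRel grX2 ![0, x, 0, 0, 0] ![0, 1, 0, 0, 0] := by
    intro x hx
    rcases Int.isUnit_iff.1 (isUnit_of_dvd_one hx) with rfl | rfl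
    · exact VRel.refl _ _
    · exact rel_of x2c (by simp only [act_mul, act2, act5] <;> simp)
  have swp : ∀ b c d : ℤ, VRel grX2 ![0, b, c, d, 0] ![0, d, c, b, 0] := fun b c d =>
    rel_of x2a (act1 ..)
  by_cases hb : b = 0
  · subst hb
    have hc : c = 0 := by simpa using hq
    subst hc
    exact (swp ..).trans (sgn d (hp.dvd (by simp) (by simp) (by simp) dvd_rfl (by simp)))
  have r := mvX (-(c / b)) b c d
  have hq2 := r.qf_eq (grX2_le.trans grE_le)
  rw [qf_vec, qf_vec] at hq2
  rw [show c + -(c / b) * b = c % b by rw [Int.emod_def]; ring] at r hq2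
  set d1 := d - 2 * -(c / b) * c - (-(c / b)) ^ 2 * b
  have h1 := Int.emod_nonneg c hb
  have h2 := Int.emod_lt_abs c hb
  have r' := r.trans (swp ..)
  refine r'.trans (ih d1.natAbs ?_ _ _ _ rfl (by linarith) (r'.prim hp))
  rw [← hn]
  zify
  have h3 : |b| * |d1| = (c % b) ^ 2 := by
    rw [← abs_mul, show b * d1 = -(c % b) ^ 2 by linarith, abs_neg, abs_of_nonneg (sq_nonneg _)]
  by_contra hcon
  push Not at hcon
  nlinarith [abs_nonneg b, abs_nonneg d1]

theorem x3 : s1 * (s2 * s3 * s2) * s1 ∈ grX3 :=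
  ⟨mul_mem (mul_mem x2a x2b) x2a, by
    refine mem_fixG.2 ?_; simp only [act_mul, act2, act3, act1] <;> simp⟩

theorem stage4 (b c : ℤ) (hq : b + c ^ 2 = 0) :
    VRel grX3 ![0, b, c, 1, 0] ![0, 0, 0, 1, 0] := by
  have r := VRel.iter (X := grX3) (fun k => ![0, b - 2 * k * c - k ^ 2, c + k, 1, 0])
    (fun k => rel_of x3 (by
      simp only [act_mul, act3, act2, act1]; congr! 2; · ring
      congr! 1; ring)) (-c)
  simp only [zero_mul, sub_zero, add_zero, mul_zero, add_neg_cancel, ne_eq, OfNat.ofNat_ne_zero,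
    not_false_eq_true, zero_pow] at r
  rwa [show b - 2 * -c * c - (-c) ^ 2 = 0 by linarith] at r

theorem x4 : s4 ∈ grX4 :=
  ⟨⟨⟨⟨s4_mem, by simp [mem_fixG, act4]⟩, by simp [mem_fixG, act4]⟩, by simp [mem_fixG, act4]⟩,
    by simp [mem_fixG, act4]⟩

/-- The polar form of `qf`. -/
theorem polar_eq {g : GL (Fin 5) ℤ} (hg : g ∈ isoG) (v w : Fin 5 → ℤ) :
    qf (g.val *ᵥ v + g.val *ᵥ w) = qf (v + w) := by
  rw [← Matrix.mulVec_add, hg]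

theorem prim_act (g : GL (Fin 5) ℤ) {v : Fin 5 → ℤ} (hv : Prim v) : Prim (g.val *ᵥ v) :=
  VRel.prim (X := ⊤) ⟨g, trivial, rfl⟩ hv

theorem isoG_le : isoG ≤ grE := by
  intro g hg
  -- first vector
  obtain ⟨h1, hh1, e1⟩ := reduce_vec (g.val *ᵥ ![1, 0, 0, 0, 0]) (by rw [hg]; simp)
    (prim_act g ⟨![1, 0, 0, 0, 0], by simp⟩)
  rw [← act_mul] at e1
  suffices h : h1 * g ∈ grE by simpa using mul_mem (inv_mem hh1) h
  have hg1 : h1 * g ∈ isoG := mul_mem (grE_le hh1) hg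
  clear hg
  generalize h1 * g = g1 at *
  clear h1 hh1 g
  -- second vector
  have q1 := hg1 ![0, 0, 0, 0, 1]
  have p1 := polar_eq hg1 ![1, 0, 0, 0, 0] ![0, 0, 0, 0, 1]
  rw [e1] at p1
  obtain ⟨h2, hh2, e2⟩ : VRel grX1 (g1.val *ᵥ ![0, 0, 0, 0, 1]) ![0, 0, 0, 0, 1] := by
    rw [vec5 (g1.val *ᵥ ![0, 0, 0, 0, 1])] at q1 p1 ⊢
    simp only [Matrix.add_cons, Matrix.head_cons, Matrix.tail_cons, Matrix.empty_add_empty,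
      qf_vec] at q1 p1
    have h4 : (g1.val *ᵥ ![0, 0, 0, 0, 1]) 4 = 1 := by linarith
    rw [h4] at q1 ⊢
    exact stage2 _ _ _ _ (by linarith)
  rw [← act_mul] at e2
  suffices h : h2 * g1 ∈ grE by simpa using mul_mem (inv_mem (grX1_le hh2)) h
  have hg2 : h2 * g1 ∈ isoG := mul_mem (grE_le (grX1_le hh2)) hg1
  have e1' : (h2 * g1).val *ᵥ ![1, 0, 0, 0, 0] = ![1, 0, 0, 0, 0] := by
    rw [act_mul, e1]; exact hh2.2
  clear e1 q1 p1 hg1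
  generalize h2 * g1 = g2 at *
  clear h2 hh2 g1
  -- images of vectors orthogonal to `e₀`, `e₄`
  have form : ∀ (g : GL (Fin 5) ℤ), g ∈ isoG → g.val *ᵥ ![1, 0, 0, 0, 0] = ![1, 0, 0, 0, 0] →
      g.val *ᵥ ![0, 0, 0, 0, 1] = ![0, 0, 0, 0, 1] → ∀ b c d : ℤ, ∃ b' c' d',
      g.val *ᵥ ![0, b, c, d, 0] = ![0, b', c', d', 0] ∧ b' * d' + c' ^ 2 = b * d + c ^ 2 := by
    intro g hg ea eb b c d
    have q1 := hg ![0, b, c, d, 0]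
    have p1 := polar_eq hg ![1, 0, 0, 0, 0] ![0, b, c, d, 0]
    have p2 := polar_eq hg ![0, 0, 0, 0, 1] ![0, b, c, d, 0]
    rw [ea] at p1
    rw [eb] at p2
    rw [vec5 (g.val *ᵥ ![0, b, c, d, 0])] at q1 p1 p2 ⊢
    generalize g.val *ᵥ ![0, b, c, d, 0] = w at *
    simp only [Matrix.add_cons, Matrix.head_cons, Matrix.tail_cons, Matrix.empty_add_empty,
      qf_vec] at q1 p1 p2
    have h4 : w 4 = 0 := by linarith
    have h0 : w 0 = 0 := by linarith
    rw [h4, h0] at q1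
    exact ⟨w 1, w 2, w 3, by rw [h4, h0], by linarith⟩
  -- third vector
  obtain ⟨b, c, d, e3, q3⟩ := form g2 hg2 e1' e2 1 0 0
  obtain ⟨h3, hh3, e3'⟩ := stage3 _ b c d rfl (by linarith)
    (e3 ▸ prim_act g2 ⟨![0, 1, 0, 0, 0], by simp⟩)
  rw [← e3, ← act_mul] at e3'
  suffices h : h3 * g2 ∈ grE by simpa using mul_mem (inv_mem (grX2_le hh3)) h
  have hg3 : h3 * g2 ∈ isoG := mul_mem (grE_le (grX2_le hh3)) hg2
  have f1 : (h3 * g2).val *ᵥ ![1, 0, 0, 0, 0] = ![1, 0, 0, 0, 0] := by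
    rw [act_mul, e1']; exact hh3.1.2
  have f2 : (h3 * g2).val *ᵥ ![0, 0, 0, 0, 1] = ![0, 0, 0, 0, 1] := by
    rw [act_mul, e2]; exact hh3.2
  clear e1' e2 e3 q3 hg2
  generalize h3 * g2 = g3 at *
  clear h3 hh3 g2 b c d
  -- fourth vector
  obtain ⟨b, c, d, e4, q4⟩ := form g3 hg3 f1 f2 0 0 1
  have p4 := polar_eq hg3 ![0, 1, 0, 0, 0] ![0, 0, 0, 1, 0]
  rw [e3', e4] at p4
  simp only [Matrix.add_cons, Matrix.head_cons, Matrix.tail_cons, Matrix.empty_add_empty,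
    qf_vec] at p4
  have hd : d = 1 := by linarith
  subst hd
  obtain ⟨h4, hh4, e4'⟩ := stage4 b c (by linarith)
  rw [← e4, ← act_mul] at e4'
  suffices h : h4 * g3 ∈ grE by simpa using mul_mem (inv_mem (grX3_le hh4)) h
  have hg4 : h4 * g3 ∈ isoG := mul_mem (grE_le (grX3_le hh4)) hg3
  have k1 : (h4 * g3).val *ᵥ ![1, 0, 0, 0, 0] = ![1, 0, 0, 0, 0] := by
    rw [act_mul, f1]; exact hh4.1.1.2
  have k2 : (h4 * g3).val *ᵥ ![0, 0, 0, 0, 1] = ![0, 0, 0, 0, 1] := by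
    rw [act_mul, f2]; exact hh4.1.2
  have k3 : (h4 * g3).val *ᵥ ![0, 1, 0, 0, 0] = ![0, 1, 0, 0, 0] := by
    rw [act_mul, e3']; exact hh4.2
  clear f1 f2 e3' e4 q4 hg3 p4
  generalize h4 * g3 = g4 at *
  clear h4 hh4 g3 b c
  -- fifth vector
  obtain ⟨b, c, d, e5, q5⟩ := form g4 hg4 k1 k2 0 1 0
  have p5 := polar_eq hg4 ![0, 1, 0, 0, 0] ![0, 0, 1, 0, 0]
  have p6 := polar_eq hg4 ![0, 0, 0, 1, 0] ![0, 0, 1, 0, 0]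
  rw [k3, e5] at p5
  rw [e4', e5] at p6
  simp only [Matrix.add_cons, Matrix.head_cons, Matrix.tail_cons, Matrix.empty_add_empty,
    qf_vec] at p5 p6
  have hd : d = 0 := by linarith
  have hb : b = 0 := by linarith
  subst hd hb
  have fin : ∀ g : GL (Fin 5) ℤ, g.val *ᵥ ![1, 0, 0, 0, 0] = ![1, 0, 0, 0, 0] →
      g.val *ᵥ ![0, 1, 0, 0, 0] = ![0, 1, 0, 0, 0] → g.val *ᵥ ![0, 0, 1, 0, 0] = ![0, 0, 1, 0, 0] →
      g.val *ᵥ ![0, 0, 0, 1, 0] = ![0, 0, 0, 1, 0] → g.val *ᵥ ![0, 0, 0, 0, 1] = ![0, 0, 0, 0, 1] →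
      g = 1 := by
    intro g t0 t1 t2 t3 t4
    apply Units.ext
    ext i j
    have t0 := congrFun t0 i
    have t1 := congrFun t1 i
    have t2 := congrFun t2 i
    have t3 := congrFun t3 i
    have t4 := congrFun t4 i
    simp only [Matrix.mulVec, dotProduct, Fin.sum_univ_five] at t0 t1 t2 t3 t4
    fin_cases j <;> fin_cases i <;> simp_all
  have hc : c = 1 ∨ c = -1 := by
    have : c ^ 2 = 1 := by linarith
    exact sq_eq_one_iff.1 this
  rcases hc with rfl | rfl
  · rw [fin g4 k1 k3 e5 e4' k2]
    exact one_mem _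
  · have : s4 * g4 = 1 := by
      apply fin
      · rw [act_mul, k1, act4]; simp
      · rw [act_mul, k3, act4]; simp
      · rw [act_mul, e5, act4]; simp
      · rw [act_mul, e4', act4]; simp
      · rw [act_mul, k2, act4]; simp
    rw [eq_inv_of_mul_eq_one_right this]
    exact inv_mem s4_mem

/-! ### Passing to a lattice on which the form is split -/

/-- The columns of `matP` span an invariant lattice. -/
def matP : Matrix (Fin 5) (Fin 5) ℤ :=
  !![0, 0, -2, 1, 0; -1, -1, 2, -2, 0; 0, 2, 0, 2, 0; 0, -2, -2, -1, 2; -1, -1, -2, 2, -2]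
/-- `16` times the inverse of `matP`. -/
def matR : Matrix (Fin 5) (Fin 5) ℤ :=
  !![-16, -16, -8, 0, 0; 24, 8, 0, -8, -8; -20, -4, 4, 4, 4; -24, -8, 8, 8, 8; -8, 0, 8, 8, 0]
/-- A quarter of `matQ * matP`. -/
def matY : Matrix (Fin 5) (Fin 5) ℤ :=
  !![1, 3, 5, -3, 2; 0, 1, 1, -1, 2; -1, -1, -1, 0, 1; -1, -1, -1, 1, 0; 0, -1, -1, 1, 0]
/-- First Bezout matrix. -/
def matU : Matrix (Fin 5) (Fin 5) ℤ :=
  !![-2, -1, 0, 0, -1; 3, 2, 1, -1, -3; -2, 0, 1, 1, 1; 0, 1, 1, -1, -3; 0, 0, 0, -1, -2]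
/-- Second Bezout matrix. -/
def matW : Matrix (Fin 5) (Fin 5) ℤ :=
  !![-1, 0, 0, 0, -1; -1, -1, 0, 0, 0; 0, 0, 0, -1, 0; -2, 0, 0, 0, 0; -1, 0, 1, 0, 0]
/-- The split form. -/
def matJ : Matrix (Fin 5) (Fin 5) ℤ :=
  !![0, 0, 0, 0, 1; 0, 0, 0, 1, 0; 0, 0, 2, 0, 0; 0, 1, 0, 0, 0; 1, 0, 0, 0, 0]

theorem matR_mul_matP : matR * matP = (16 : ℤ) • 1 := by decide +kernel
theorem matP_mul_matR : matP * matR = (16 : ℤ) • 1 := by decide +kernel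
theorem matQ_mul_matP : matQ * matP = (4 : ℤ) • matY := by decide +kernel
theorem bezout_eq : (4 : ℤ) • (matP * matU) + matP * matW * matQ = (4 : ℤ) • 1 := by decide +kernel
theorem gram_eq : matPᵀ * matQ * matP = (-8 : ℤ) • matJ := by decide +kernel

theorem smul_cancel {n : ℤ} (hn : n ≠ 0) {X Y : Matrix (Fin 5) (Fin 5) ℤ} (h : n • X = n • Y) :
    X = Y := smul_right_injective _ hn h

theorem cancel_left {X Y : Matrix (Fin 5) (Fin 5) ℤ} (h : matP * X = matP * Y) : X = Y := by
  have h2 : matR * (matP * X) = matR * (matP * Y) := by rw [h]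
  rw [← mul_assoc, ← mul_assoc, matR_mul_matP, smul_mul_assoc, smul_mul_assoc, one_mul, one_mul] at h2
  exact smul_cancel (by norm_num) h2

theorem cancel_right {X Y : Matrix (Fin 5) (Fin 5) ℤ} (h : X * matP = Y * matP) : X = Y := by
  have h2 : X * matP * matR = Y * matP * matR := by rw [h]
  rw [mul_assoc, mul_assoc, matP_mul_matR, mul_smul_comm, mul_smul_comm, mul_one, mul_one] at h2
  exact smul_cancel (by norm_num) h2

/-- The matrix of `g` on the invariant lattice. -/
def latMat (g : GL (Fin 5) ℤ) : Matrix (Fin 5) (Fin 5) ℤ :=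
  matU * g.val * matP + matW * (g⁻¹).valᵀ * matY

theorem latMat_spec {g : GL (Fin 5) ℤ} (hg : g ∈ orthogonalSubgroup matQ) :
    matP * latMat g = g.val * matP := by
  have hg' : g.valᵀ * matQ * g.val = matQ := hg
  have h1 : (g⁻¹).valᵀ * matQ = matQ * g.val := by
    conv_lhs => rw [← hg']
    rw [← mul_assoc, ← mul_assoc, ← transpose_mul, Units.mul_inv, transpose_one, one_mul]
  apply smul_cancel (n := 4) (by norm_num)
  calc (4 : ℤ) • (matP * latMat g)
      = ((4 : ℤ) • (matP * matU)) * g.val * matP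
          + matP * matW * (g⁻¹).valᵀ * ((4 : ℤ) • matY) := by
        simp only [latMat, mul_add, smul_add, smul_mul_assoc, mul_smul_comm, mul_assoc]
    _ = ((4 : ℤ) • (matP * matU)) * g.val * matP
          + matP * matW * ((g⁻¹).valᵀ * matQ) * matP := by
        rw [← matQ_mul_matP]; simp only [mul_assoc]
    _ = ((4 : ℤ) • (matP * matU) + matP * matW * matQ) * g.val * matP := by
        rw [h1]; simp only [add_mul, mul_assoc]
    _ = (4 : ℤ) • (g.val * matP) := by
        rw [bezout_eq]; simp only [smul_mul_assoc, one_mul]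

/-- The action on the lattice, as a monoid homomorphism. -/
def latHom : orthogonalSubgroup matQ →* Matrix (Fin 5) (Fin 5) ℤ where
  toFun g := latMat g.1
  map_one' := by
    apply cancel_left
    rw [latMat_spec (1 : orthogonalSubgroup matQ).2]
    simp
  map_mul' g h := by
    apply cancel_left
    rw [latMat_spec (g * h).2, ← mul_assoc, latMat_spec g.2, mul_assoc, latMat_spec h.2,
      ← mul_assoc]
    rfl

/-- The action on the lattice, as a group homomorphism. -/
def latG : orthogonalSubgroup matQ →* GL (Fin 5) ℤ := latHom.toHomUnits

theorem latG_val (g : orthogonalSubgroup matQ) : (latG g).val = latMat g.1 := rfl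

theorem latG_inj : Function.Injective latG := by
  intro g h hgh
  apply Subtype.ext
  apply Units.ext
  apply cancel_right
  rw [← latMat_spec g.2, ← latMat_spec h.2, ← latG_val, ← latG_val, hgh]

theorem qf_eq_matJ (v : Fin 5 → ℤ) : v ⬝ᵥ (matJ *ᵥ v) = 2 * qf v := by
  simp only [dotProduct, matJ, Matrix.mulVec, Fin.sum_univ_five, qf]
  simp
  ring

theorem latG_range : latG.range ≤ isoG := by
  rintro _ ⟨g, rfl⟩ v
  have hg : g.1.valᵀ * matQ * g.1.val = matQ := g.2
  have h := latMat_spec g.2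
  rw [latG_val]
  have hJ : (latMat g.1)ᵀ * matJ * latMat g.1 = matJ := by
    apply smul_cancel (n := -8) (by norm_num)
    calc (-8 : ℤ) • ((latMat g.1)ᵀ * matJ * latMat g.1)
        = (latMat g.1)ᵀ * ((-8 : ℤ) • matJ) * latMat g.1 := by
          rw [mul_smul_comm, smul_mul_assoc]
      _ = (matP * latMat g.1)ᵀ * matQ * (matP * latMat g.1) := by
          rw [← gram_eq, transpose_mul]; simp only [mul_assoc]
      _ = matPᵀ * (g.1.valᵀ * matQ * g.1.val) * matP := by
          rw [h, transpose_mul]; simp only [mul_assoc]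
      _ = (-8 : ℤ) • matJ := by rw [hg, gram_eq]
  have h2 := qf_eq_matJ (latMat g.1 *ᵥ v)
  have h3 := qf_eq_matJ v
  have h4 : (latMat g.1 *ᵥ v) ⬝ᵥ (matJ *ᵥ (latMat g.1 *ᵥ v)) = v ⬝ᵥ (matJ *ᵥ v) := by
    conv_rhs => rw [← hJ]
    rw [← Matrix.mulVec_mulVec, ← Matrix.mulVec_mulVec, Matrix.dotProduct_mulVec v,
      Matrix.vecMul_transpose]
  linarith

theorem latMat_A {A : GL (Fin 5) ℤ} (hA : A.val = matA) (hA' : A ∈ orthogonalSubgroup matQ) :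
    latMat A = gA.toM := by
  apply cancel_left
  rw [latMat_spec hA', hA]
  decide +kernel

theorem latMat_B {B : GL (Fin 5) ℤ} (hB : B.val = matB) (hB' : B ∈ orthogonalSubgroup matQ) :
    latMat B = gB.toM := by
  apply cancel_left
  rw [latMat_spec hB', hB]
  decide +kernel

theorem relIndex_total : (grp [gA, gB]).relIndex grE ≠ 0 :=
  Subgroup.relIndex_ne_zero_trans (Subgroup.relIndex_ne_zero_trans (Subgroup.relIndex_ne_zero_trans
    (Subgroup.relIndex_ne_zero_trans (Subgroup.relIndex_ne_zero_trans step0 step1) step2) step3)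
    step4) step5

theorem orth_A : matAᵀ * matQ * matA = matQ := by decide +kernel
theorem orth_B : matBᵀ * matQ * matB = matQ := by decide +kernel

/-- Case 3 of Theorem 1.2: the hypergeometric group `Γ(f,g)` generated by the companion matrices `A`, `B`
of `f(x) = x^5 - 2*x^4 + x^3 - x^2 + 2*x - 1` and `g(x) = x^5 - x^4 + x^3 + x^2 - x + 1`
is an arithmetic subgroup of `O_Q(ℤ)`: it preserves `Q`, it is contained in `O_Q(ℤ)`,
and it has finite index in `O_Q(ℤ)`. -/
theorem hypergeometric_group_arithmetic
    (A B : GL (Fin 5) ℤ)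
    (hA : (A : Matrix (Fin 5) (Fin 5) ℤ) = matA)
    (hB : (B : Matrix (Fin 5) (Fin 5) ℤ) = matB) :
    matAᵀ * matQ * matA = matQ ∧
    matBᵀ * matQ * matB = matQ ∧
    Subgroup.closure {A, B} ≤ orthogonalSubgroup matQ ∧
    ((Subgroup.closure {A, B}).subgroupOf (orthogonalSubgroup matQ)).FiniteIndex := by
  have mA : A ∈ orthogonalSubgroup matQ := by
    change A.valᵀ * matQ * A.val = matQ
    rw [hA, orth_A]
  have mB : B ∈ orthogonalSubgroup matQ := by
    change B.valᵀ * matQ * B.val = matQ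
    rw [hB, orth_B]
  refine ⟨orth_A, orth_B, ?_, ?_⟩
  · rw [Subgroup.closure_le]
    rintro _ (rfl | rfl)
    · exact mA
    · exact mB
  · have h1 : (grp [gA, gB]).relIndex latG.range ≠ 0 := fun h =>
      relIndex_total (Subgroup.relIndex_eq_zero_of_le_right (latG_range.trans isoG_le) h)
    rw [← Subgroup.index_comap] at h1
    have h2 : (grp [gA, gB]).comap latG ≤
        (Subgroup.closure {A, B}).subgroupOf (orthogonalSubgroup matQ) := by
      have h3 : grp [gA, gB] ≤
          ((Subgroup.closure {A, B}).subgroupOf (orthogonalSubgroup matQ)).map latG := by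
        unfold grp
        rw [Subgroup.closure_le]
        rintro g ⟨v, hv, hg⟩
        simp only [List.mem_cons, List.not_mem_nil, or_false] at hv
        rcases hv with rfl | rfl
        · refine ⟨⟨A, mA⟩, Subgroup.subset_closure (by simp), Units.ext ?_⟩
          rw [latG_val, latMat_A hA mA, hg]
        · refine ⟨⟨B, mB⟩, Subgroup.subset_closure (by simp), Units.ext ?_⟩
          rw [latG_val, latMat_B hB mB, hg]
      refine (Subgroup.comap_mono h3).trans ?_
      rw [Subgroup.comap_map_eq_self_of_injective latG_inj]
    have : ((grp [gA, gB]).comap latG).FiniteIndex := ⟨h1⟩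
    exact Subgroup.finiteIndex_of_le h2
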